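/- Let 𝒢 be a fully-coloured acyclic q-multicolouring of a finite graph G = (V,E), and assume G is an s-connector. Let K be a hyperedge of 𝒞(𝒢) of maximum size. Then |V ∖ K| ≤ 13(s−1). -/

import Mathlib

open SimpleGraph

variable {V : Type*}

/-- `M` is a set of edges of `G` forming a matching (pairwise disjoint edges). -/
def IsMatchingSet (G : SimpleGraph V) (M : Finset (Sym2 V)) : Prop :=
  (∀ e ∈ M, e ∈ G.edgeSet) ∧
    ∀ e ∈ M, ∀ f ∈ M, e ≠ f → ∀ v : V, v ∈ e → v ∉ f

/-- The matching number `ν(G)`. -/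
noncomputable def matchingNumber (G : SimpleGraph V) : ℕ :=
  sSup {n | ∃ M : Finset (Sym2 V), IsMatchingSet G M ∧ M.card = n}

/-- `ν_G(X,Y)`: the maximum size of a matching of `G` each edge of which has one
endpoint in `X` and one endpoint in `Y`. -/
noncomputable def nuBetween (G : SimpleGraph V) (X Y : Set V) : ℕ :=
  sSup {n | ∃ M : Finset (Sym2 V), IsMatchingSet G M ∧ M.card = n ∧
    ∀ e ∈ M, ∃ x ∈ X, ∃ y ∈ Y, e = s(x, y)}

/-- The set `D` of the Gallai–Edmonds decomposition: the inessential vertices,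
i.e. those missed by some maximum matching. -/
def geD (G : SimpleGraph V) : Set V :=
  {v | ∃ M : Finset (Sym2 V), IsMatchingSet G M ∧ M.card = matchingNumber G ∧ ∀ e ∈ M, v ∉ e}

/-- The set `A` of the Gallai–Edmonds decomposition: vertices outside `D` with a
neighbour in `D`. -/
def geA (G : SimpleGraph V) : Set V :=
  {v | v ∉ geD G ∧ ∃ u ∈ geD G, G.Adj v u}

/-- The set `C` of the Gallai–Edmonds decomposition: the remaining vertices. -/
def geC (G : SimpleGraph V) : Set V :=
  {v | v ∉ geD G ∧ v ∉ geA G}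

/-- `G` is an `s`-connector: any two disjoint vertex sets of size at least `s`
are joined by an edge. -/
def IsConnector (G : SimpleGraph V) (s : ℕ) : Prop :=
  ∀ X Y : Set V, Disjoint X Y → s ≤ X.ncard → s ≤ Y.ncard →
    ∃ x ∈ X, ∃ y ∈ Y, G.Adj x y

/-- `G → (t₁K₂, …, t_qK₂)`: every `q`-colouring of the edges of `G` admits a colour
`j` and a `j`-monochromatic matching of size `t j`. -/
def ArrowsMatch (G : SimpleGraph V) {q : ℕ} (t : Fin q → ℕ) : Prop :=
  ∀ c : Sym2 V → Fin q, ∃ j : Fin q, ∃ M : Finset (Sym2 V),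
    IsMatchingSet G M ∧ M.card = t j ∧ ∀ e ∈ M, c e = j

/-- The induced subgraph `G[S]`, viewed as a graph on the same vertex set. -/
def inducedOn (G : SimpleGraph V) (S : Set V) : SimpleGraph V where
  Adj a b := G.Adj a b ∧ a ∈ S ∧ b ∈ S
  symm := ⟨fun _ _ ⟨h, ha, hb⟩ => ⟨h.symm, hb, ha⟩⟩
  loopless := ⟨fun a h => G.loopless.irrefl a h.1⟩

/-- Remove from `G` every edge incident to `S`. -/
def removeIncident (G : SimpleGraph V) (S : Set V) : SimpleGraph V where
  Adj a b := G.Adj a b ∧ a ∉ S ∧ b ∉ S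
  symm := ⟨fun _ _ ⟨h, ha, hb⟩ => ⟨h.symm, hb, ha⟩⟩
  loopless := ⟨fun a h => G.loopless.irrefl a h.1⟩

/-- The subgraph of `G` consisting of the edges incident to `S`. -/
def incidentSub (G : SimpleGraph V) (S : Set V) : SimpleGraph V where
  Adj a b := G.Adj a b ∧ (a ∈ S ∨ b ∈ S)
  symm := ⟨fun _ _ ⟨h, hs⟩ => ⟨h.symm, hs.symm⟩⟩
  loopless := ⟨fun a h => G.loopless.irrefl a h.1⟩

/-- The vertex set of the connected component of `v` in `G`. -/
def compSet (G : SimpleGraph V) (v : V) : Set V := {u | G.Reachable u v}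

/-- The family of vertex sets of the connected components of `G[S]` meeting `S`. -/
def compsOn (G : SimpleGraph V) (S : Set V) : Set (Set V) :=
  {K | ∃ v ∈ S, K = compSet (inducedOn G S) v}

/-- `G[S]` is factor-critical: for every `v ∈ S` there is a matching of `G[S]`
avoiding `v` and covering all other vertices of `S`. -/
def IsFactorCriticalOn (G : SimpleGraph V) (S : Set V) : Prop :=
  ∀ v ∈ S, ∃ M : Finset (Sym2 V), IsMatchingSet (inducedOn G S) M ∧
    (∀ e ∈ M, v ∉ e) ∧ ∀ u ∈ S, u ≠ v → ∃ e ∈ M, u ∈ e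

/-- The bipartite incidence graph of an indexed (multi)hypergraph. -/
def incGraph {ι : Type*} (E : ι → Set V) : SimpleGraph (V ⊕ ι) where
  Adj x y :=
    (∃ v i, x = Sum.inl v ∧ y = Sum.inr i ∧ v ∈ E i) ∨
    (∃ v i, x = Sum.inr i ∧ y = Sum.inl v ∧ v ∈ E i)
  symm := ⟨by
    rintro x y (⟨v, i, rfl, rfl, h⟩ | ⟨v, i, rfl, rfl, h⟩)
    · exact Or.inr ⟨v, i, rfl, rfl, h⟩
    · exact Or.inl ⟨v, i, rfl, rfl, h⟩⟩
  loopless := ⟨by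
    rintro x (⟨v, i, rfl, h, -⟩ | ⟨v, i, rfl, h, -⟩) <;> simp at h⟩

/-- An indexed (multi)hypergraph is a hyperforest if its incidence graph has no cycle. -/
def IsHyperforest {ι : Type*} (E : ι → Set V) : Prop := (incGraph E).IsAcyclic

/-- Index type of the multihypergraph `𝒞(𝒢)` of monochromatic connected components:
a colour together with the vertex set of a component of that colour graph. -/
def CompIdx {q : ℕ} (Gc : Fin q → SimpleGraph V) : Type _ :=
  Σ j : Fin q, {K : Set V // ∃ v : V, K = compSet (Gc j) v}

/-- The hyperedges of the multihypergraph `𝒞(𝒢)`. -/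
def CompEdge {q : ℕ} (Gc : Fin q → SimpleGraph V) : CompIdx Gc → Set V :=
  fun p => (p.2 : Set V)

/-- A coloured graph is acyclic if `𝒞(𝒢)` is a hyperforest. -/
def ColouringAcyclic {q : ℕ} (Gc : Fin q → SimpleGraph V) : Prop :=
  IsHyperforest (CompEdge Gc)

/-- `(G₀, G₁, …, G_q)` is a `q`-multicolouring of `G`: the union of all
(coloured and uncoloured) edge sets is the edge set of `G`. -/
def IsMulticolouring (G G0 : SimpleGraph V) {q : ℕ} (Gc : Fin q → SimpleGraph V) : Prop :=
  G0 ⊔ (⨆ j, Gc j) = G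

/-- The colouring `(G₀, G₁, …, G_q)` of `G` is `S`-proper: the uncoloured edges are
exactly the edges of `G` incident to `S`, and they carry no colour. -/
def IsSProper (G G0 : SimpleGraph V) {q : ℕ} (Gc : Fin q → SimpleGraph V) (S : Set V) : Prop :=
  G0.edgeSet = {e | e ∈ G.edgeSet ∧ ∃ v ∈ S, v ∈ e} ∧
    ∀ j, Disjoint G0.edgeSet (Gc j).edgeSet

/-- The potential `σ_𝒢(T) = r_𝒢(T) - |T|`, where
`r_𝒢(T) = ∑_j |A_j ∩ T| + ∑_j ∑_i (ν(G_j[K_j^i]) - ν(G_j[K_j^i ∖ T]))`,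
the inner sum running over the components `K_j^i` of `G_j[D_j]`. -/
noncomputable def sigmaCol {q : ℕ} (Gc : Fin q → SimpleGraph V) (T : Set V) : ℤ :=
  ((∑ j : Fin q, ((geA (Gc j) ∩ T).ncard : ℤ))
    + ∑ j : Fin q, ∑ᶠ K ∈ compsOn (Gc j) (geD (Gc j)),
        ((matchingNumber (inducedOn (Gc j) K) : ℤ)
          - (matchingNumber (inducedOn (Gc j) (K \ T)) : ℤ)))
    - (T.ncard : ℤ)

/-- `T` is `σ_𝒢`-maximal. -/
def SigmaMaximal {q : ℕ} (Gc : Fin q → SimpleGraph V) (T : Set V) : Prop :=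
  (∀ S : Set V, sigmaCol Gc S ≤ sigmaCol Gc T) ∧
    ∀ T' : Set V, T ⊂ T' → sigmaCol Gc T' < sigmaCol Gc T

/-- The graph joining two distinct vertices whenever they lie in a common hyperedge `E k`
with `P k`. -/
def linkGraph {V ι : Type*} (E : ι → Set V) (P : ι → Prop) : SimpleGraph V where
  Adj a b := a ≠ b ∧ ∃ k, P k ∧ a ∈ E k ∧ b ∈ E k
  symm := ⟨fun _ _ ⟨h, k, hk, ha, hb⟩ => ⟨h.symm, k, hk, hb, ha⟩⟩
  loopless := ⟨fun _ h => h.1 rfl⟩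

/-- In a hyperforest, two vertices of a hyperedge are not linked by the other hyperedges. -/
theorem IsHyperforest.eq_of_reachable_linkGraph {V ι : Type*} {E : ι → Set V}
    (hE : IsHyperforest E) {i : ι} {w w' : V} (hw : w ∈ E i) (hw' : w' ∈ E i)
    (h : (linkGraph E (· ≠ i)).Reachable w w') : w = w' := by
  by_contra hne
  have hadj : (incGraph E).Adj (Sum.inl w) (Sum.inr i) := Or.inl ⟨w, i, rfl, rfl, hw⟩
  have hbr := isBridge_iff.mp (isAcyclic_iff_forall_adj_isBridge.mp hE hadj)
  set T := (incGraph E).deleteEdges {s(Sum.inl w, Sum.inr i)} with hT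
  have hTadj : ∀ a k, a ∈ E k → (a ≠ w ∨ k ≠ i) → T.Adj (Sum.inl a) (Sum.inr k) := by
    intro a k ha hak
    rw [hT, deleteEdges_adj]
    refine ⟨Or.inl ⟨a, k, rfl, rfl, ha⟩, ?_⟩
    simp only [Set.mem_singleton_iff, Sym2.eq_iff, Sum.inl.injEq, Sum.inr.injEq, reduceCtorEq,
      and_self, or_false]
    tauto
  have hreach : ∀ a b, (linkGraph E (· ≠ i)).Reachable a b →
      T.Reachable (Sum.inl a) (Sum.inl b) := by
    rintro a b ⟨p⟩
    induction p with
    | nil => exact Reachable.refl _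
    | cons hab _ ih =>
      obtain ⟨-, k, hk, ha, hb⟩ := hab
      exact (hTadj _ k ha (Or.inr hk)).reachable.trans
        ((hTadj _ k hb (Or.inr hk)).symm.reachable.trans ih)
  exact hbr ((hreach w w' h).trans (hTadj w' i hw' (Or.inl (Ne.symm hne))).reachable)

/-- If every fibre of `c` meets `A` in at most `m` points and `A` has more than `3 * m` points,
then the fibres can be grouped into two classes each containing more than `m` points of `A`. -/
theorem exists_balanced_fibers {V Q : Type*} [Finite V] [Finite Q] (c : V → Q) (A : Set V)
    {m : ℕ} (hA : 3 * m + 1 ≤ A.ncard) (hc : ∀ x, (A ∩ c ⁻¹' {x}).ncard ≤ m) :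
    ∃ S : Set Q, m + 1 ≤ (A ∩ c ⁻¹' S).ncard ∧ m + 1 ≤ (A ∩ c ⁻¹' Sᶜ).ncard := by
  obtain ⟨S, hS, hmin⟩ := Set.Finite.exists_minimal
    (Set.toFinite {S : Set Q | m + 1 ≤ (A ∩ c ⁻¹' S).ncard})
    ⟨Set.univ, by simp only [Set.mem_ofPred_eq, Set.preimage_univ, Set.inter_univ]; omega⟩
  simp only [Set.mem_ofPred_eq] at hS
  refine ⟨S, hS, ?_⟩
  have hne : S.Nonempty := by
    by_contra hemp
    rw [Set.not_nonempty_iff_eq_empty] at hemp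
    simp [hemp] at hS
  obtain ⟨x, hx⟩ := hne
  have hlt : (A ∩ c ⁻¹' (S \ {x})).ncard ≤ m := by
    by_contra hcon
    have := hmin (y := S \ {x}) (by simp only [Set.mem_ofPred_eq]; omega) Set.sdiff_subset hx
    simp at this
  have hcover : A ∩ c ⁻¹' S ⊆ (A ∩ c ⁻¹' (S \ {x})) ∪ (A ∩ c ⁻¹' {x}) := by
    rintro a ⟨ha, haS⟩
    by_cases hax : c a = x
    · exact Or.inr ⟨ha, hax⟩
    · exact Or.inl ⟨ha, haS, hax⟩
  have h1 := Set.ncard_le_ncard hcover (Set.toFinite _)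
  have h2 := Set.ncard_union_le (A ∩ c ⁻¹' (S \ {x})) (A ∩ c ⁻¹' {x})
  have h3 : A ⊆ (A ∩ c ⁻¹' S) ∪ (A ∩ c ⁻¹' Sᶜ) := by
    intro a ha
    by_cases haS : c a ∈ S
    · exact Or.inl ⟨ha, haS⟩
    · exact Or.inr ⟨ha, haS⟩
  have h4 := Set.ncard_le_ncard h3 (Set.toFinite _)
  have h5 := Set.ncard_union_le (A ∩ c ⁻¹' S) (A ∩ c ⁻¹' Sᶜ)
  have h6 := hc x
  omega

/-- If `H` contains all edges of a connector inside a large set `A`, then some component of `H`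
meets `A` in a large set. -/
theorem IsConnector.exists_large_component {V : Type*} [Finite V] {G H : SimpleGraph V} {m : ℕ}
    (hG : IsConnector G (m + 1)) {A : Set V} (hH : ∀ a ∈ A, ∀ b ∈ A, G.Adj a b → H.Adj a b)
    (hA : 3 * m + 1 ≤ A.ncard) :
    ∃ C : H.ConnectedComponent, m + 1 ≤ (A ∩ C.supp).ncard := by
  by_contra! hcon
  have : Finite H.ConnectedComponent := Quot.finite _
  obtain ⟨S, hS, hS'⟩ := exists_balanced_fibers H.connectedComponentMk A hA
    (fun C => Nat.le_of_lt_succ (hcon C))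
  obtain ⟨x, ⟨hxA, hx⟩, y, ⟨hyA, hy⟩, hxy⟩ := hG _ _
    (Set.disjoint_left.mpr fun a ha ha' => ha'.2 ha.2) hS hS'
  have heq : H.connectedComponentMk x = H.connectedComponentMk y :=
    ConnectedComponent.sound (hH x hxA y hyA hxy).reachable
  apply hy
  rw [Set.mem_preimage] at hx
  rwa [← heq]

/-- Deleting a vertex `v` from a large connector leaves a component `S` missing at most `m`
of the remaining vertices. -/
theorem IsConnector.exists_large_component_avoiding {V : Type*} [Finite V] {G : SimpleGraph V}
    {m : ℕ} (hG : IsConnector G (m + 1)) (hV : 3 * m + 2 ≤ Nat.card V) (v : V) :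
    ∃ S : Set V, v ∉ S ∧ S.Nonempty ∧ (∀ a ∈ S, ∀ b, b ≠ v → G.Adj a b → b ∈ S) ∧
      (∀ D : Set V, (∀ a ∈ D, a ∈ S → ∀ b ∈ S, G.Adj a b → b ∈ D) →
        (∃ a ∈ D, a ∈ S) → S ⊆ D) ∧
      Nat.card V ≤ S.ncard + (m + 1) := by
  have hcard : ({v}ᶜ : Set V).ncard + 1 = Nat.card V := by
    have := Set.ncard_add_ncard_compl ({v} : Set V)
    rw [Set.ncard_singleton] at this
    omega
  obtain ⟨C, hC⟩ := hG.exists_large_component (H := removeIncident G {v}) (A := {v}ᶜ)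
    (fun a ha b hb hab => ⟨hab, ha, hb⟩) (by omega)
  have hclosed : ∀ a ∈ C.supp, a ≠ v → ∀ b, b ≠ v → G.Adj a b → b ∈ C.supp := by
    intro a ha hav b hb hab
    have hadj : (removeIncident G {v}).Adj a b := ⟨hab, hav, hb⟩
    exact C.mem_supp_of_adj_mem_supp ha hadj
  obtain ⟨x, hxv, hxC⟩ : ({v}ᶜ ∩ C.supp).Nonempty := by
    rw [Set.nonempty_iff_ne_empty]
    intro h
    simp [h] at hC
  have hind : ∀ D : Set V, (∀ a ∈ D, a ∈ C.supp → ∀ b ∈ C.supp,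
      (removeIncident G {v}).Adj a b → b ∈ D) → (∃ a ∈ D, a ∈ C.supp) → C.supp ⊆ D := by
    rintro D hD ⟨a, haD, haC⟩ b hbC
    obtain ⟨p⟩ : (removeIncident G {v}).Reachable a b := C.reachable_of_mem_supp haC hbC
    induction p with
    | nil => exact haD
    | cons hab _ ih =>
      have := C.mem_supp_of_adj_mem_supp haC hab
      exact ih (hD _ haD haC _ this hab) this hbC
  have hvC : v ∉ C.supp := fun hv =>
    hxv (hind {v} (fun a ha _ b _ hab => (hab.2.1 ha).elim) ⟨v, rfl, hv⟩ hxC)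
  have hne : ∀ a ∈ C.supp, a ≠ v := fun a ha h => hvC (h ▸ ha)
  refine ⟨C.supp, hvC, ⟨x, hxC⟩, fun a ha => hclosed a ha (hne a ha),
    fun D hD => hind D fun a haD haC b hb hab => hD a haD haC b hb hab.1, ?_⟩
  by_contra! hlt
  have h1 := Set.ncard_add_ncard_compl C.supp
  have h2 : (C.suppᶜ \ {v}).ncard + 1 = C.suppᶜ.ncard :=
    Set.ncard_sdiff_singleton_add_one hvC (Set.toFinite _)
  have h3 : m + 1 ≤ C.supp.ncard :=
    hC.trans (Set.ncard_le_ncard Set.inter_subset_right (Set.toFinite _))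
  obtain ⟨a, ha, b, hb, hab⟩ := hG C.supp (C.suppᶜ \ {v})
    (Set.disjoint_left.mpr fun a ha ha' => ha'.1 ha) h3 (by omega)
  exact hb.1 (hclosed a ha (hne a ha) b hb.2 hab)

/-- A large connector all of whose edges lie in hyperedges of a hyperforest has a hyperedge
missing at most `3 * m` vertices. -/
theorem IsHyperforest.exists_ncard_compl_le {V ι : Type*} [Finite V] {E : ι → Set V}
    (hE : IsHyperforest E) {m : ℕ} (hG : IsConnector (linkGraph E fun _ => True) (m + 1))
    (hV : 3 * m + 2 ≤ Nat.card V) : ∃ i, (E i)ᶜ.ncard ≤ 3 * m := by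
  set G := linkGraph E fun _ => True with hGdef
  choose h hself hnonempty hclosed hconn hcard using hG.exists_large_component_avoiding hV
  have : Nonempty V := (Nat.card_pos_iff.mp (by omega)).1
  obtain ⟨v, hv⟩ := Finite.exists_min fun v => (h v).ncard
  have hlarge : ∀ S T : Set V, Disjoint S T → S.ncard + T.ncard ≤ Nat.card V := by
    intro S T hST
    rw [← Set.ncard_union_eq hST (Set.toFinite _) (Set.toFinite _)]
    exact Set.ncard_le_card _
  have hmem : ∀ w ∈ h v, v ∈ h w := by
    intro w hw
    by_contra hvw
    have hmeet : ∃ a ∈ h v, a ∈ h w := by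
      by_contra! hdisj
      have h1 := hlarge (insert v (h v)) (h w) (by
        rw [Set.disjoint_insert_left]
        exact ⟨hvw, Set.disjoint_left.mpr hdisj⟩)
      rw [Set.ncard_insert_of_notMem (hself v) (Set.toFinite _)] at h1
      have := hcard v
      have := hcard w
      omega
    have hsub : h w ⊆ h v := hconn w (h v)
      (fun a ha _ b hb hab => hclosed v a ha b (fun hbv => hvw (hbv ▸ hb)) hab) hmeet
    have hss : h w ⊂ h v := hsub.ssubset_of_mem_notMem hw (hself w)
    exact absurd (hv w) (not_le.mpr (Set.ncard_lt_ncard hss (Set.toFinite _)))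
  obtain ⟨b, hb, hvb⟩ : ∃ b ∈ h v, G.Adj v b := by
    by_contra! hno
    have hstay : ∀ a ∈ h v, ∀ c, G.Adj a c → c ∈ h v := by
      intro a ha c hac
      refine hclosed v a ha c ?_ hac
      rintro rfl
      exact hno a ha hac.symm
    have hsum := Set.ncard_add_ncard_compl (h v)
    have hv1 := hcard v
    have hcompl : (h v)ᶜ.ncard ≤ m := by
      by_contra! hlt
      obtain ⟨a, ha, c, hc, hac⟩ := hG (h v) (h v)ᶜ disjoint_compl_right (by omega) hlt
      exact hc (hstay a ha c hac)
    obtain ⟨w, hw⟩ := hnonempty v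
    have hsub : h w ⊆ (h v)ᶜ := hconn w (h v)ᶜ
      (fun a ha _ c _ hac hc => ha (hstay c hc a hac.symm)) ⟨v, hself v, hmem w hw⟩
    have h2 := Set.ncard_le_ncard hsub (Set.toFinite _)
    have h3 := hcard w
    omega
  obtain ⟨-, i, -, hvi, hbi⟩ := id hvb
  have hbv : b ≠ v := hvb.ne'
  have hadj : ∀ x ∈ E i, ∀ y ∈ E i, x ≠ y → G.Adj x y := fun x hx y hy hxy =>
    ⟨hxy, i, trivial, hx, hy⟩
  have hroot : ∀ w ∈ E i, ∃ z ∈ E i, z ∈ h w := by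
    intro w hw
    by_cases hwv : w = v
    · exact ⟨b, hbi, hwv ▸ hb⟩
    · refine ⟨v, hvi, hmem w ?_⟩
      by_cases hwb : w = b
      · exact hwb ▸ hb
      · exact hclosed v b hb w hwv (hadj b hbi w hw (Ne.symm hwb))
  refine ⟨i, ?_⟩
  by_contra! hlt
  obtain ⟨C, hC⟩ := hG.exists_large_component (H := linkGraph E (· ≠ i)) (A := (E i)ᶜ)
    (by
      rintro a ha c - ⟨hac, k, -, hak, hck⟩
      exact ⟨hac, k, fun hki => ha (hki ▸ hak), hak, hck⟩) hlt
  obtain ⟨w, hw, hwC⟩ : ∃ w ∈ E i, ∀ x ∈ E i, x ∈ C.supp → x = w := by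
    by_cases hex : ∃ w ∈ E i, w ∈ C.supp
    · obtain ⟨w, hw, hwC⟩ := hex
      exact ⟨w, hw, fun x hx hxC =>
        hE.eq_of_reachable_linkGraph hx hw (C.reachable_of_mem_supp hxC hwC)⟩
    · exact ⟨v, hvi, fun x hx hxC => (hex ⟨x, hx, hxC⟩).elim⟩
  obtain ⟨z, hz, hzw⟩ := hroot w hw
  have hzC : z ∉ C.supp := fun hzC => hself w (hwC z hz hzC ▸ hzw)
  have havoid : h w ⊆ ((E i)ᶜ ∩ C.supp)ᶜ := by
    refine hconn w _ ?_ ⟨z, fun hz' => hzC hz'.2, hzw⟩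
    rintro a ha haw c - ⟨hac, k, -, hak, hck⟩ ⟨hcE, hcC⟩
    have hca : (linkGraph E (· ≠ i)).Adj c a :=
      ⟨hac.symm, k, fun hki => hcE (hki ▸ hck), hck, hak⟩
    have haC : a ∈ C.supp := C.mem_supp_of_adj_mem_supp hcC hca
    by_cases haE : a ∈ E i
    · exact hself w (hwC a haE haC ▸ haw)
    · exact ha ⟨haE, haC⟩
  have h1 := hlarge (insert w (h w)) ((E i)ᶜ ∩ C.supp) (by
    rw [Set.disjoint_insert_left]
    exact ⟨fun hw' => hw'.1 hw, Set.disjoint_left.mpr havoid⟩)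
  rw [Set.ncard_insert_of_notMem (hself w) (Set.toFinite _)] at h1
  have h2 := hcard w
  omega

/-- **Lemma 3.8 (small components).** If `𝒢` is a fully-coloured acyclic
`q`-multicolouring of an `s`-connector `G` and `K` is a maximum-size hyperedge of `𝒞(𝒢)`,
then `|V ∖ K| ≤ 13(s - 1)`. -/
theorem small_components {V : Type*} [Fintype V] {q s : ℕ} (hs : 1 ≤ s)
    (G G0 : SimpleGraph V)
    (Gc : Fin q → SimpleGraph V) (hcol : IsMulticolouring G G0 Gc)
    (hfull : G0 = ⊥) (hacyc : ColouringAcyclic Gc) (hG : IsConnector G s)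
    (p : CompIdx Gc)
    (hmax : ∀ p' : CompIdx Gc, (CompEdge Gc p').ncard ≤ (CompEdge Gc p).ncard) :
    ((CompEdge Gc p)ᶜ).ncard ≤ 13 * (s - 1) := by
  obtain ⟨m, rfl⟩ := Nat.exists_eq_add_of_le' hs
  have hlink : IsConnector (linkGraph (CompEdge Gc) fun _ => True) (m + 1) := by
    intro X Y hXY hX hY
    obtain ⟨x, hx, y, hy, hxy⟩ := hG X Y hXY hX hY
    have hne := hxy.ne
    rw [← hcol, hfull, bot_sup_eq, iSup_adj] at hxy
    obtain ⟨j, hj⟩ := hxy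
    exact ⟨x, hx, y, hy, hne, ⟨j, compSet (Gc j) x, x, rfl⟩, trivial, Reachable.refl x,
      hj.symm.reachable⟩
  have hpos : 0 < (CompEdge Gc p).ncard := by
    obtain ⟨j, K, v, rfl⟩ := p
    exact (Set.ncard_pos (Set.toFinite _)).mpr ⟨v, Reachable.refl v⟩
  have hsum := Set.ncard_add_ncard_compl (CompEdge Gc p)
  by_contra! hlt
  obtain ⟨i, hi⟩ := IsHyperforest.exists_ncard_compl_le hacyc hlink (by omega)
  have hsum' := Set.ncard_add_ncard_compl (CompEdge Gc i)
  have := hmax i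
  omega
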